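/- arXiv:2301.01793 — 2 statements merged into one kernel-verified Lean document; each statement's English description precedes it below -/
import Mathlib

section
/- Let n ≥ 1, 0 < γ ≤ 1/3, 0 < ε < 1, and let Ω ⊂ ℂⁿ be a bounded domain with B_{1−γ} ⊂ Ω ⊂ B_{1+γ}. Let v₀ ∈ C²(Ω) ∩ C(Ω̄) be plurisubharmonic with det((v₀)_{ij̄}) = 1 in Ω and v₀ = 0 on ∂Ω, and let u ∈ C²(Ω) ∩ C(Ω̄) be plurisubharmonic with det(u_{ij̄}) = f in Ω, u = 0 on ∂Ω, where 1 − ε ≤ f ≤ 1 + ε in Ω. Then (1 + ε)^{1/n} · v₀ ≤ u ≤ (1 − ε)^{1/n} · v₀ in Ω; in particular |v₀(z) − u(z)| ≤ 4ε for all z ∈ Ω. -/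
open Metric MeasureTheory ComplexOrder

noncomputable section

/-- Wirtinger derivative `∂f/∂z_i = (1/2)(∂/∂x_i - i ∂/∂y_i)` of `f` at `z`. -/
def wdz (n : ℕ) (f : EuclideanSpace ℂ (Fin n) → ℂ) (i : Fin n)
    (z : EuclideanSpace ℂ (Fin n)) : ℂ :=
  (1 / 2) * (fderiv ℝ f z (EuclideanSpace.single i 1) -
    Complex.I * fderiv ℝ f z (EuclideanSpace.single i Complex.I))

/-- Conjugate Wirtinger derivative `∂f/∂z̄_j = (1/2)(∂/∂x_j + i ∂/∂y_j)` of `f` at `z`. -/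
def wdzbar (n : ℕ) (f : EuclideanSpace ℂ (Fin n) → ℂ) (j : Fin n)
    (z : EuclideanSpace ℂ (Fin n)) : ℂ :=
  (1 / 2) * (fderiv ℝ f z (EuclideanSpace.single j 1) +
    Complex.I * fderiv ℝ f z (EuclideanSpace.single j Complex.I))

/-- Complex Hessian matrix `(φ_{i j̄}(z)) = (∂²φ/∂z_i∂z̄_j(z))` of a real-valued function. -/
def cHess (n : ℕ) (φ : EuclideanSpace ℂ (Fin n) → ℝ) (z : EuclideanSpace ℂ (Fin n)) :
    Matrix (Fin n) (Fin n) ℂ :=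
  Matrix.of fun i j => wdz n (fun w => wdzbar n (fun v => (φ v : ℂ)) j w) i z

/-- Linearized complex Monge–Ampère operator
`L_φ u = det(φ_{k l̄}) · Σ_{i,j} φ^{i j̄} u_{i j̄}`. -/
def Lop (n : ℕ) (φ u : EuclideanSpace ℂ (Fin n) → ℝ) (z : EuclideanSpace ℂ (Fin n)) : ℂ :=
  (cHess n φ z).det * ∑ i, ∑ j, (cHess n φ z)⁻¹ i j * cHess n u z i j

open scoped Matrix

lemma Matrix.PosDef.one_lt_det_one_add {n : Type*} [Fintype n] [DecidableEq n] [Nonempty n]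
    {Q : Matrix n n ℂ} (hQ : Q.PosDef) : 1 < (1 + Q).det := by
  have h1 : (1 + Q).det = ∏ i, ((1 + hQ.1.eigenvalues i : ℝ) : ℂ) := by
    have h2 := congrArg (Polynomial.eval (-1)) hQ.1.charpoly_eq
    rw [Matrix.eval_charpoly, Polynomial.eval_prod] at h2
    have h3 : Matrix.scalar n (-1 : ℂ) - Q = -(1 + Q) := by
      rw [map_neg, map_one]; abel
    rw [h3, Matrix.det_neg] at h2
    have h4 : ∀ i, Polynomial.eval (-1 : ℂ) (Polynomial.X - Polynomial.C
        ((hQ.1.eigenvalues i : ℝ) : ℂ)) = (-1) * ((1 + hQ.1.eigenvalues i : ℝ) : ℂ) := by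
      intro i; simp; ring
    have h5 : (-1 : ℂ) ^ Fintype.card n * (1 + Q).det =
        (-1 : ℂ) ^ Fintype.card n * ∏ i, ((1 + hQ.1.eigenvalues i : ℝ) : ℂ) := by
      rw [h2]
      erw [Finset.prod_congr rfl fun i _ => h4 i]
      rw [Finset.prod_mul_distrib]; simp
    exact mul_left_cancel₀ (by simp) h5
  rw [h1, ← Complex.ofReal_prod]
  have h6 : (1 : ℝ) < ∏ i, (1 + hQ.1.eigenvalues i) := by
    have h7 := Finset.prod_lt_prod_of_nonempty (s := Finset.univ) (f := fun _ : n => (1 : ℝ))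
      (g := fun i => 1 + hQ.1.eigenvalues i) (by simp)
      (fun i _ => by linarith [hQ.eigenvalues_pos i]) Finset.univ_nonempty
    simpa using h7
  exact_mod_cast h6

lemma Matrix.PosSemidef.det_lt_det_add {n : Type*} [Fintype n] [DecidableEq n] [Nonempty n]
    {A P : Matrix n n ℂ} (hA : A.PosSemidef) (hP : P.PosDef) : A.det < (A + P).det := by
  by_cases h0 : A.det = 0
  · rw [h0]
    exact (Matrix.PosDef.posSemidef_add hA hP).det_pos
  obtain ⟨B, rfl⟩ : ∃ B : Matrix n n ℂ, A = Bᴴ * B := by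
    open scoped MatrixOrder in
    exact CStarAlgebra.nonneg_iff_eq_star_mul_self.mp hA.nonneg
  have hB : B.det ≠ 0 := fun h => h0 (by simp [h])
  have hu : IsUnit B.det := isUnit_iff_ne_zero.mpr hB
  have hQ : ((B⁻¹)ᴴ * P * B⁻¹).PosDef :=
    hP.conjTranspose_mul_mul_same
      (Matrix.mulVec_injective_of_isUnit ((Matrix.isUnit_nonsing_inv_iff).2 ((Matrix.isUnit_iff_isUnit_det B).2 hu)))
  have hE : Bᴴ * B + P = Bᴴ * (1 + (B⁻¹)ᴴ * P * B⁻¹) * B := by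
    have h1 : Bᴴ * (B⁻¹)ᴴ = 1 := by
      rw [← Matrix.conjTranspose_mul, Matrix.nonsing_inv_mul _ hu, Matrix.conjTranspose_one]
    have h2 : Bᴴ * ((B⁻¹)ᴴ * P * B⁻¹) * B = (Bᴴ * (B⁻¹)ᴴ) * P * (B⁻¹ * B) := by
      simp only [Matrix.mul_assoc]
    rw [mul_add, add_mul, h2, h1, Matrix.nonsing_inv_mul _ hu]
    simp
  have hpos : 0 < (Bᴴ * B).det := lt_of_le_of_ne hA.det_nonneg (Ne.symm h0)
  calc (Bᴴ * B).det = (Bᴴ * B).det * 1 := (mul_one _).symm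
    _ < (Bᴴ * B).det * (1 + (B⁻¹)ᴴ * P * B⁻¹).det :=
        mul_lt_mul_of_pos_left hQ.one_lt_det_one_add hpos
    _ = _ := by rw [hE, Matrix.det_mul, Matrix.det_mul, Matrix.det_mul]; ring

lemma deriv_deriv_nonpos_of_isLocalMax {g : ℝ → ℝ} {x : ℝ} (h : IsLocalMax g x)
    (hc : ContinuousAt g x) : deriv (deriv g) x ≤ 0 := by
  by_contra! hpos
  have hmin := isLocalMin_of_deriv_deriv_pos hpos h.deriv_eq_zero hc
  have heq : g =ᶠ[nhds x] fun _ => g x := by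
    filter_upwards [h, hmin] with y h1 h2 using le_antisymm h1 h2
  have := heq.deriv.deriv_eq
  simp at this
  linarith

section SecondDerivative

variable {E : Type*} [NormedAddCommGroup E] [NormedSpace ℝ E]

lemma fderiv_fderiv_apply_self_nonpos_of_isLocalMax {g : E → ℝ} {z : E}
    (hg : ContDiffAt ℝ 2 g z) (h : IsLocalMax g z) (a : E) :
    fderiv ℝ (fderiv ℝ g) z a a ≤ 0 := by
  set l : ℝ → E := fun t => z + t • a with hl
  have hl0 : l 0 = z := by simp [hl]
  have hld : ∀ t, HasDerivAt l a t := fun t => by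
    simpa [hl] using ((hasDerivAt_id t).smul_const a).const_add z
  have hlc : ContinuousAt l 0 := (hld 0).continuousAt
  have hlt : Filter.Tendsto l (nhds 0) (nhds z) := by simpa [ContinuousAt, hl0] using hlc
  have hd : ∀ᶠ w in nhds z, DifferentiableAt ℝ g w := by
    filter_upwards [hg.eventually (by simp)] with w hw using hw.differentiableAt (by simp)
  have h1 : deriv (g ∘ l) =ᶠ[nhds 0] fun t => fderiv ℝ g (l t) a := by
    filter_upwards [hlt.eventually hd] with t ht
    exact (ht.hasFDerivAt.comp_hasDerivAt t (hld t)).deriv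
  have h2 : DifferentiableAt ℝ (fderiv ℝ g) (l 0) := by
    rw [hl0]
    exact (hg.fderiv_right (m := 1) (by norm_num)).differentiableAt (by simp)
  have h3 : deriv (deriv (g ∘ l)) 0 = fderiv ℝ (fderiv ℝ g) z a a := by
    rw [h1.deriv_eq]
    have h4 := (h2.hasFDerivAt.comp_hasDerivAt 0 (hld 0)).clm_apply (hasDerivAt_const 0 a)
    rw [hl0] at h4
    simpa using h4.deriv
  rw [← h3]
  refine deriv_deriv_nonpos_of_isLocalMax ?_ ?_
  · have := hlt.eventually h
    filter_upwards [this] with t ht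
    simpa [hl0] using ht
  · exact ContinuousAt.comp (by rw [hl0]; exact hg.continuousAt) hlc

end SecondDerivative

/-- The entries of the complex Hessian in terms of the real second derivative. -/
lemma cHess_apply {n : ℕ} {φ : EuclideanSpace ℂ (Fin n) → ℝ} {z : EuclideanSpace ℂ (Fin n)}
    (hφ : ContDiffAt ℝ 2 φ z) (i j : Fin n) :
    cHess n φ z i j = (1 / 4) *
      (((fderiv ℝ (fderiv ℝ φ) z (EuclideanSpace.single i 1) (EuclideanSpace.single j 1) +
        fderiv ℝ (fderiv ℝ φ) z (EuclideanSpace.single i Complex.I)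
          (EuclideanSpace.single j Complex.I) : ℝ) : ℂ) +
      Complex.I * ((fderiv ℝ (fderiv ℝ φ) z (EuclideanSpace.single i 1)
          (EuclideanSpace.single j Complex.I) -
        fderiv ℝ (fderiv ℝ φ) z (EuclideanSpace.single i Complex.I)
          (EuclideanSpace.single j 1) : ℝ) : ℂ)) := by
  have hd : ∀ᶠ w in nhds z, DifferentiableAt ℝ φ w := by
    filter_upwards [hφ.eventually (by simp)] with w hw using hw.differentiableAt (by simp)
  have h1 : (fun w => wdzbar n (fun v => (φ v : ℂ)) j w) =ᶠ[nhds z] fun w =>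
      (1 / 2 : ℂ) * (((fderiv ℝ φ w (EuclideanSpace.single j 1) : ℝ) : ℂ) +
        Complex.I * ((fderiv ℝ φ w (EuclideanSpace.single j Complex.I) : ℝ) : ℂ)) := by
    filter_upwards [hd] with w hw
    have := (Complex.ofRealCLM.hasFDerivAt.comp w hw.hasFDerivAt).fderiv
    change fderiv ℝ (fun v => (φ v : ℂ)) w = _ at this
    simp [wdzbar, this]
  have h2 : HasFDerivAt (fderiv ℝ φ) (fderiv ℝ (fderiv ℝ φ) z) z :=
    ((hφ.fderiv_right (m := 1) (by norm_num)).differentiableAt (by simp)).hasFDerivAt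
  have h3 : ∀ b, HasFDerivAt (fun w => ((fderiv ℝ φ w b : ℝ) : ℂ))
      (Complex.ofRealCLM.comp ((fderiv ℝ (fderiv ℝ φ) z).flip b)) z := fun b => by
    have := h2.clm_apply (hasFDerivAt_const b z)
    have := Complex.ofRealCLM.hasFDerivAt.comp z this
    convert! this using 2
    ext; simp
  have h4 := ((h3 (EuclideanSpace.single j 1)).add
    ((h3 (EuclideanSpace.single j Complex.I)).const_mul Complex.I)).const_mul (1 / 2 : ℂ)
  have h5 := h1.fderiv_eq.trans h4.fderiv
  simp only [cHess, Matrix.of_apply, wdz]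
  rw [h5]
  simp
  linear_combination (-1/4 * ((fderiv ℝ (fderiv ℝ φ) z (EuclideanSpace.single i Complex.I)
          (EuclideanSpace.single j Complex.I) : ℝ) : ℂ)) * Complex.I_sq

lemma cHess_add {n : ℕ} {φ ψ : EuclideanSpace ℂ (Fin n) → ℝ} {z : EuclideanSpace ℂ (Fin n)}
    (hφ : ContDiffAt ℝ 2 φ z) (hψ : ContDiffAt ℝ 2 ψ z) :
    cHess n (fun w => φ w + ψ w) z = cHess n φ z + cHess n ψ z := by
  have h : fderiv ℝ (fun w => φ w + ψ w) =ᶠ[nhds z] fderiv ℝ φ + fderiv ℝ ψ := by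
    filter_upwards [hφ.eventually (by simp), hψ.eventually (by simp)] with w h1 h2
    exact fderiv_fun_add (h1.differentiableAt (by simp)) (h2.differentiableAt (by simp))
  have h' : fderiv ℝ (fderiv ℝ (fun w => φ w + ψ w)) z =
      fderiv ℝ (fderiv ℝ φ) z + fderiv ℝ (fderiv ℝ ψ) z := by
    rw [h.fderiv_eq, fderiv_add
      ((hφ.fderiv_right (m := 1) (by norm_num)).differentiableAt (by simp))
      ((hψ.fderiv_right (m := 1) (by norm_num)).differentiableAt (by simp))]
  ext i j
  rw [Matrix.add_apply, cHess_apply (hφ.add hψ), cHess_apply hφ, cHess_apply hψ, h']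
  simp only [_root_.add_apply]
  push_cast
  ring

lemma cHess_const_mul {n : ℕ} {φ : EuclideanSpace ℂ (Fin n) → ℝ} {z : EuclideanSpace ℂ (Fin n)}
    (hφ : ContDiffAt ℝ 2 φ z) (c : ℝ) :
    cHess n (fun w => c * φ w) z = (c : ℂ) • cHess n φ z := by
  have h : fderiv ℝ (fun w => c * φ w) =ᶠ[nhds z] c • fderiv ℝ φ := by
    filter_upwards [hφ.eventually (by simp)] with w h1
    exact fderiv_const_mul (h1.differentiableAt (by simp)) c
  have h' : fderiv ℝ (fderiv ℝ (fun w => c * φ w)) z = c • fderiv ℝ (fderiv ℝ φ) z := by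
    rw [h.fderiv_eq, fderiv_const_smul
      ((hφ.fderiv_right (m := 1) (by norm_num)).differentiableAt (by simp))]
  ext i j
  rw [Matrix.smul_apply, cHess_apply (contDiffAt_const.mul hφ), cHess_apply hφ, h']
  simp only [_root_.smul_apply, smul_eq_mul]
  push_cast
  ring

lemma cHess_const {n : ℕ} (c : ℝ) (z : EuclideanSpace ℂ (Fin n)) :
    cHess n (fun _ => c) z = 0 := by
  ext i j
  simp [cHess_apply contDiffAt_const]

lemma cHess_norm_sq {n : ℕ} (z : EuclideanSpace ℂ (Fin n)) :
    cHess n (fun w => ‖w‖ ^ 2) z = 1 := by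
  have h : ∀ a b : EuclideanSpace ℂ (Fin n),
      fderiv ℝ (fderiv ℝ fun w : EuclideanSpace ℂ (Fin n) => ‖w‖ ^ 2) z a b =
        2 * inner ℝ a b := fun a b => by
    have h1 : fderiv ℝ (fderiv ℝ fun w : EuclideanSpace ℂ (Fin n) => ‖w‖ ^ 2) z =
        2 • innerSL ℝ := by
      rw [fderiv_norm_sq]
      exact (2 • innerSL ℝ (E := EuclideanSpace ℂ (Fin n))).fderiv
    rw [h1, two_mul, two_smul]
    rfl
  have hin : ∀ (i j : Fin n) (c d : ℂ),
      inner ℝ (EuclideanSpace.single i c) (EuclideanSpace.single j d) =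
        if i = j then inner ℝ c d else 0 := fun i j c d => by
    rw [PiLp.inner_apply, Finset.sum_eq_single i]
    · by_cases hij : i = j <;> simp [hij]
    · intro k _ hk
      simp [hk]
    · simp
  ext i j
  rw [cHess_apply (contDiff_norm_sq ℝ).contDiffAt, h, h, h, h, hin, hin, hin, hin]
  by_cases hij : i = j
  · subst hij
    simp [Complex.inner]
    norm_num
  · simp [hij]

lemma EuclideanSpace.bilin_apply_eq_sum {n : ℕ}
    (B : EuclideanSpace ℂ (Fin n) →L[ℝ] EuclideanSpace ℂ (Fin n) →L[ℝ] ℝ)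
    (a b : EuclideanSpace ℂ (Fin n)) :
    B a b = ∑ i, ∑ j,
      ((a i).re * (b j).re * B (single i 1) (single j 1) +
        (a i).re * (b j).im * B (single i 1) (single j Complex.I) +
        (a i).im * (b j).re * B (single i Complex.I) (single j 1) +
        (a i).im * (b j).im * B (single i Complex.I) (single j Complex.I)) := by
  have h : ∀ c : EuclideanSpace ℂ (Fin n),
      c = ∑ i, ((c i).re • single i (1 : ℂ) + (c i).im • single i Complex.I) := fun c => by
    ext k
    simp [Finset.sum_apply, Pi.single_apply, Finset.sum_add_distrib]
  conv_lhs => rw [h a, h b]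
  simp only [map_sum, map_add, map_smul, _root_.sum_apply,
    _root_.add_apply, _root_.smul_apply, smul_eq_mul,
    Finset.mul_sum, ← Finset.sum_add_distrib]
  rw [Finset.sum_comm]
  refine Finset.sum_congr rfl fun i _ => Finset.sum_congr rfl fun j _ => ?_
  ring

lemma star_dotProduct_cHess_mulVec {n : ℕ} {φ : EuclideanSpace ℂ (Fin n) → ℝ}
    {z : EuclideanSpace ℂ (Fin n)} (hφ : ContDiffAt ℝ 2 φ z) (a : EuclideanSpace ℂ (Fin n)) :
    (a : Fin n → ℂ) ⬝ᵥ (cHess n φ z *ᵥ star (a : Fin n → ℂ)) =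
      (((1 / 4) * (fderiv ℝ (fderiv ℝ φ) z a a +
        fderiv ℝ (fderiv ℝ φ) z (Complex.I • a) (Complex.I • a)) : ℝ) : ℂ) := by
  set B := fderiv ℝ (fderiv ℝ φ) z with hB
  have hsymm : B (Complex.I • a) a = B a (Complex.I • a) :=
    hφ.isSymmSndFDerivAt (by simp) _ _
  have h1 : (a : Fin n → ℂ) ⬝ᵥ (cHess n φ z *ᵥ star (a : Fin n → ℂ)) =
      (1 / 4) * (((B a a + B (Complex.I • a) (Complex.I • a) : ℝ) : ℂ) +
        Complex.I * ((B a (Complex.I • a) - B (Complex.I • a) a : ℝ) : ℂ)) := by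
    rw [EuclideanSpace.bilin_apply_eq_sum B a a,
      EuclideanSpace.bilin_apply_eq_sum B (Complex.I • a) (Complex.I • a),
      EuclideanSpace.bilin_apply_eq_sum B a (Complex.I • a),
      EuclideanSpace.bilin_apply_eq_sum B (Complex.I • a) a,
      ← Finset.sum_add_distrib, ← Finset.sum_sub_distrib]
    simp only [← Finset.sum_add_distrib, ← Finset.sum_sub_distrib]
    simp only [dotProduct, Matrix.mulVec, Complex.ofReal_sum, Finset.mul_sum,
      ← Finset.sum_add_distrib]
    refine Finset.sum_congr rfl fun i _ => Finset.sum_congr rfl fun j _ => ?_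
    rw [cHess_apply hφ, ← hB]
    apply Complex.ext
    · simp
      ring
    · simp
      ring
  rw [h1, hsymm]
  push_cast
  ring

lemma cHess_isHermitian {n : ℕ} {φ : EuclideanSpace ℂ (Fin n) → ℝ}
    {z : EuclideanSpace ℂ (Fin n)} (hφ : ContDiffAt ℝ 2 φ z) : (cHess n φ z).IsHermitian := by
  have hsymm := hφ.isSymmSndFDerivAt (by simp)
  ext i j
  rw [Matrix.conjTranspose_apply, cHess_apply hφ, cHess_apply hφ,
    hsymm (EuclideanSpace.single j 1) (EuclideanSpace.single i 1),
    hsymm (EuclideanSpace.single j 1) (EuclideanSpace.single i Complex.I),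
    hsymm (EuclideanSpace.single j Complex.I) (EuclideanSpace.single i 1),
    hsymm (EuclideanSpace.single j Complex.I) (EuclideanSpace.single i Complex.I)]
  apply Complex.ext <;> simp

lemma IsLocalMax.neg_cHess_posSemidef {n : ℕ} {φ : EuclideanSpace ℂ (Fin n) → ℝ}
    {z : EuclideanSpace ℂ (Fin n)} (h : IsLocalMax φ z) (hφ : ContDiffAt ℝ 2 φ z) :
    (-cHess n φ z).PosSemidef := by
  refine .of_dotProduct_mulVec_nonneg (cHess_isHermitian hφ).neg fun x => ?_
  have h1 := star_dotProduct_cHess_mulVec hφ (WithLp.toLp 2 (star x))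
  simp only [star_star] at h1
  rw [Matrix.neg_mulVec, dotProduct_neg, h1, ← Complex.ofReal_neg]
  have h2 := fderiv_fderiv_apply_self_nonpos_of_isLocalMax hφ h
  have h3 := h2 (WithLp.toLp 2 (star x))
  have h4 := h2 (Complex.I • WithLp.toLp 2 (star x))
  exact Complex.zero_le_real.2 (by linarith)

/-- Comparison principle for the complex Monge–Ampère operator. -/
theorem le_of_det_cHess_le {n : ℕ} [NeZero n] {Ω : Set (EuclideanSpace ℂ (Fin n))}
    (hΩ : IsOpen Ω) (hΩb : Bornology.IsBounded Ω) {φ ψ : EuclideanSpace ℂ (Fin n) → ℝ}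
    (hφ : ContDiffOn ℝ 2 φ Ω) (hψ : ContDiffOn ℝ 2 ψ Ω)
    (hφc : ContinuousOn φ (closure Ω)) (hψc : ContinuousOn ψ (closure Ω))
    (hpsh : ∀ z ∈ Ω, (cHess n φ z).PosSemidef)
    (hdet : ∀ z ∈ Ω, (cHess n ψ z).det ≤ (cHess n φ z).det)
    (hbd : ∀ z ∈ frontier Ω, φ z ≤ ψ z) {z : EuclideanSpace ℂ (Fin n)} (hz : z ∈ Ω) :
    φ z ≤ ψ z := by
  by_contra! hlt
  obtain ⟨R, hR⟩ := hΩb.closure.exists_norm_le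
  set δ : ℝ := (φ z - ψ z) / (2 * (R ^ 2 + 1)) with hδ
  have hδ0 : 0 < δ := div_pos (sub_pos.2 hlt) (by positivity)
  have hδR : δ * (2 * (R ^ 2 + 1)) = φ z - ψ z := div_mul_cancel₀ _ (by positivity)
  set g : EuclideanSpace ℂ (Fin n) → ℝ := fun w => (φ w + (-1) * ψ w) + δ * ‖w‖ ^ 2 with hg
  have hgc : ContinuousOn g (closure Ω) := by fun_prop
  obtain ⟨y, hy, hmax⟩ := hΩb.isCompact_closure.exists_isMaxOn ⟨z, subset_closure hz⟩ hgc
  have hyΩ : y ∈ Ω := by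
    by_contra hyn
    have h1 := hbd y ⟨hy, by rwa [hΩ.interior_eq]⟩
    have h2 : g z ≤ g y := hmax (subset_closure hz)
    have h3 : ‖y‖ ^ 2 ≤ R ^ 2 := by gcongr; exact hR y hy
    have h4 := mul_le_mul_of_nonneg_left h3 hδ0.le
    have h5 : 0 ≤ δ * ‖z‖ ^ 2 := by positivity
    have h6 : 0 ≤ δ * R ^ 2 := by positivity
    simp only [hg] at h2
    linarith
  have hnhds := hΩ.mem_nhds hyΩ
  have hφy := hφ.contDiffAt hnhds
  have hψy := hψ.contDiffAt hnhds
  have hny : ContDiffAt ℝ 2 (fun w : EuclideanSpace ℂ (Fin n) => ‖w‖ ^ 2) y :=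
    (contDiff_norm_sq ℝ).contDiffAt
  have hsum : ContDiffAt ℝ 2 (fun w => φ w + (-1) * ψ w) y := hφy.add (contDiffAt_const.mul hψy)
  have hneg := ((hmax.on_subset subset_closure).isLocalMax hnhds).neg_cHess_posSemidef
    (hsum.add (contDiffAt_const.mul hny))
  rw [hg, cHess_add hsum (contDiffAt_const.mul hny),
    cHess_add hφy (contDiffAt_const.mul hψy), cHess_const_mul hψy, cHess_const_mul hny,
    cHess_norm_sq] at hneg
  have hpos : (cHess n ψ y - cHess n φ y).PosDef := by
    have h1 : ((δ : ℂ) • (1 : Matrix (Fin n) (Fin n) ℂ)).PosDef :=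
      Matrix.PosDef.one.smul (by exact_mod_cast hδ0)
    convert! Matrix.PosDef.posSemidef_add hneg h1 using 1
    push_cast
    module
  have := (hpsh y hyΩ).det_lt_det_add hpos
  rw [add_sub_cancel] at this
  exact absurd this (hdet y hyΩ).not_gt

/-- comparison of the solutions of `det(u_{i j̄}) = f` (with `1-ε ≤ f ≤ 1+ε`)
and `det((v₀)_{i j̄}) = 1`, both vanishing on `∂Ω`. -/
theorem comparison_of_dirichlet_solutions
    (n : ℕ) (hn : 1 ≤ n) (γ : ℝ) (hγ0 : 0 < γ) (hγ1 : γ ≤ 1 / 3)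
    (ε : ℝ) (hε0 : 0 < ε) (hε1 : ε < 1)
    (Ω : Set (EuclideanSpace ℂ (Fin n)))
    (hΩopen : IsOpen Ω) (hΩbdd : Bornology.IsBounded Ω)
    (hΩ1 : ball 0 (1 - γ) ⊆ Ω) (hΩ2 : Ω ⊆ ball 0 (1 + γ))
    (v₀ u : EuclideanSpace ℂ (Fin n) → ℝ) (f : EuclideanSpace ℂ (Fin n) → ℝ)
    -- v₀ ∈ C²(Ω) ∩ C(Ω̄), plurisubharmonic, det((v₀)_{i j̄}) = 1 in Ω, v₀ = 0 on ∂Ω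
    (hv₀C2 : ContDiffOn ℝ 2 v₀ Ω) (hv₀cont : ContinuousOn v₀ (closure Ω))
    (hv₀psh : ∀ z ∈ Ω, (cHess n v₀ z).PosSemidef)
    (hv₀det : ∀ z ∈ Ω, (cHess n v₀ z).det = 1)
    (hv₀bd : ∀ z ∈ frontier Ω, v₀ z = 0)
    -- u ∈ C²(Ω) ∩ C(Ω̄), plurisubharmonic, det(u_{i j̄}) = f in Ω, u = 0 on ∂Ω
    (huC2 : ContDiffOn ℝ 2 u Ω) (hucont : ContinuousOn u (closure Ω))
    (hupsh : ∀ z ∈ Ω, (cHess n u z).PosSemidef)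
    (hudet : ∀ z ∈ Ω, (cHess n u z).det = ((f z : ℝ) : ℂ))
    (hf : ∀ z ∈ Ω, 1 - ε ≤ f z ∧ f z ≤ 1 + ε)
    (hubd : ∀ z ∈ frontier Ω, u z = 0) :
    ∀ z ∈ Ω,
      (1 + ε) ^ ((1 : ℝ) / n) * v₀ z ≤ u z ∧
      u z ≤ (1 - ε) ^ ((1 : ℝ) / n) * v₀ z ∧
      |v₀ z - u z| ≤ 4 * ε := by
  have : NeZero n := ⟨by omega⟩
  have hroot : ∀ x : ℝ, 0 ≤ x → (x ^ ((1 : ℝ) / n)) ^ n = x := fun x hx => by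
    rw [one_div, Real.rpow_inv_natCast_pow hx (by omega)]
  have hn1 : (1 : ℝ) / n ≤ 1 := by
    rw [div_le_one (by positivity)]; exact_mod_cast hn
  have hv : ∀ z ∈ Ω, ContDiffAt ℝ 2 v₀ z := fun z hz => hv₀C2.contDiffAt (hΩopen.mem_nhds hz)
  have hpsh : ∀ c : ℝ, 0 ≤ c → ∀ z ∈ Ω, (cHess n (fun w => c * v₀ w) z).PosSemidef :=
    fun c hc z hz => by
      rw [cHess_const_mul (hv z hz)]
      exact (hv₀psh z hz).smul (by exact_mod_cast hc)
  have hdet : ∀ c : ℝ, ∀ z ∈ Ω, (cHess n (fun w => c * v₀ w) z).det = ((c ^ n : ℝ) : ℂ) :=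
    fun c z hz => by
      rw [cHess_const_mul (hv z hz), Matrix.det_smul, hv₀det z hz]
      simp
  have hlower : ∀ z ∈ Ω, (1 + ε) ^ ((1 : ℝ) / n) * v₀ z ≤ u z := fun z hz =>
    le_of_det_cHess_le (φ := fun w => (1 + ε) ^ ((1 : ℝ) / n) * v₀ w) hΩopen hΩbdd
      (contDiffOn_const.mul hv₀C2) huC2 (continuousOn_const.mul hv₀cont) hucont
      (hpsh _ (by positivity))
      (fun w hw => by
        rw [hdet _ w hw, hudet w hw, hroot _ (by linarith)]
        exact_mod_cast (hf w hw).2)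
      (fun w hw => by simp [hv₀bd w hw, hubd w hw]) hz
  have hupper : ∀ z ∈ Ω, u z ≤ (1 - ε) ^ ((1 : ℝ) / n) * v₀ z := fun z hz =>
    le_of_det_cHess_le (ψ := fun w => (1 - ε) ^ ((1 : ℝ) / n) * v₀ w) hΩopen hΩbdd
      huC2 (contDiffOn_const.mul hv₀C2) hucont (continuousOn_const.mul hv₀cont) hupsh
      (fun w hw => by
        rw [hdet _ w hw, hudet w hw, hroot _ (by linarith)]
        exact_mod_cast (hf w hw).1)
      (fun w hw => by simp [hv₀bd w hw, hubd w hw]) hz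
  have hv₀nonpos : ∀ z ∈ Ω, v₀ z ≤ 0 := fun z hz =>
    le_of_det_cHess_le (ψ := fun _ => 0) hΩopen hΩbdd hv₀C2 contDiffOn_const hv₀cont
      continuousOn_const hv₀psh (fun w hw => by simp [cHess_const, hv₀det w hw])
      (fun w hw => (hv₀bd w hw).le) hz
  have hquad : ∀ w : EuclideanSpace ℂ (Fin n),
      cHess n (fun w => ‖w‖ ^ 2 + -(1 + γ) ^ 2) w = 1 := fun w => by
    rw [cHess_add (contDiff_norm_sq ℝ).contDiffAt contDiffAt_const, cHess_norm_sq, cHess_const,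
      add_zero]
  have hv₀lower : ∀ z ∈ Ω, -(16 / 9) ≤ v₀ z := fun z hz => by
    have h1 := le_of_det_cHess_le (φ := fun w => ‖w‖ ^ 2 + -(1 + γ) ^ 2) hΩopen hΩbdd
      ((contDiff_norm_sq ℝ).add contDiff_const).contDiffOn hv₀C2 (by fun_prop) hv₀cont
      (fun w _ => by rw [hquad]; exact .one)
      (fun w hw => by rw [hquad, hv₀det w hw, Matrix.det_one])
      (fun w hw => by
        have h2 : ‖w‖ ≤ 1 + γ := by
          simpa using closure_ball_subset_closedBall (closure_mono hΩ2 hw.1)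
        have h3 : ‖w‖ ^ 2 ≤ (1 + γ) ^ 2 := by gcongr
        rw [hv₀bd w hw]
        linarith) hz
    nlinarith [sq_nonneg ‖z‖]
  intro z hz
  refine ⟨hlower z hz, hupper z hz, ?_⟩
  have h1 : (1 + ε) ^ ((1 : ℝ) / n) ≤ 1 + ε :=
    Real.rpow_le_self_of_one_le (by linarith) hn1
  have h2 : 1 - ε ≤ (1 - ε) ^ ((1 : ℝ) / n) :=
    Real.self_le_rpow_of_le_one (by linarith) (by linarith) hn1
  have h3 := hv₀nonpos z hz
  have h4 := hv₀lower z hz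
  have h5 := hlower z hz
  have h6 := hupper z hz
  rw [abs_le]
  constructor <;> nlinarith
end
end

section
/- Let n ≥ 1 and let A be a real symmetric positive semidefinite 2n×2n matrix, written in block form A = [[P, Q], [Qᵀ, R]] with n×n blocks P, Q, R (P and R symmetric). Let H be the Hermitian n×n matrix H = (1/4)·(P + R + i(Q − Qᵀ)). Then det A ≤ 4ⁿ · (det H)². (Equivalently, (det A)^{1/2} ≤ 2ⁿ · det H; if A is the real Hessian D²φ of a C² function φ on ℂⁿ ≅ ℝ^{2n}, with rows/columns 1,…,n indexed by the x-coordinates and n+1,…,2n by the y-coordinates, then H is the complex Hessian (φ_{ij̄}) of φ, so at any point where φ is convex, det D²φ ≤ 4ⁿ·(det(φ_{ij̄}))².) -/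
open ComplexOrder Matrix

noncomputable section

/-- The Hermitian matrix `H = (1/4)·(P + R + i(Q − Qᵀ))` built from the blocks of a real
symmetric `2n×2n` matrix `[[P, Q], [Qᵀ, R]]`; when the latter is the real Hessian `D²φ`,
`H` is the complex Hessian `(φ_{i j̄})`. -/
def Hmat (n : ℕ) (P Q R : Matrix (Fin n) (Fin n) ℝ) : Matrix (Fin n) (Fin n) ℂ :=
  (1 / 4 : ℂ) • (P.map (fun x => (x : ℂ)) + R.map (fun x => (x : ℂ)) +
    Complex.I • (Q.map (fun x => (x : ℂ)) - (Q.map (fun x => (x : ℂ)))ᵀ))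

namespace Matrix

variable {𝕜 m n : Type*} [RCLike 𝕜] [Fintype m] [Fintype n] [DecidableEq m] [DecidableEq n]

theorem PosSemidef.one_le_det_one_add {A : Matrix n n 𝕜} (hA : A.PosSemidef) :
    1 ≤ (1 + A).det := by
  have h := congrArg (Polynomial.eval (-1)) hA.isHermitian.charpoly_eq
  rw [eval_charpoly, Polynomial.eval_prod] at h
  have key : (1 + A).det = ((∏ i, (1 + hA.isHermitian.eigenvalues i) : ℝ) : 𝕜) := by
    have h1 : (1 + A) = -(scalar n (-1 : 𝕜) - A) := by
      ext i j
      simp [scalar_apply, diagonal_apply, one_apply, add_comm, apply_ite]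
    rw [h1, det_neg, h, ← Finset.card_univ, ← Finset.prod_const, ← Finset.prod_mul_distrib]
    push_cast
    refine Finset.prod_congr rfl fun i _ => ?_
    simp
    ring
  rw [key]
  exact_mod_cast Finset.one_le_prod fun i _ => by
    linarith [hA.eigenvalues_nonneg i]

open scoped MatrixOrder in
theorem PosSemidef.exists_eq_conjTranspose_mul_self {A : Matrix n n 𝕜} (hA : A.PosSemidef) :
    ∃ B : Matrix n n 𝕜, A = Bᴴ * B :=
  CStarAlgebra.nonneg_iff_eq_star_mul_self.mp hA.nonneg

theorem PosSemidef.map_ofReal {A : Matrix n n ℝ} (hA : A.PosSemidef) :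
    (A.map (fun x => (x : ℂ))).PosSemidef := by
  obtain ⟨B, rfl⟩ := hA.exists_eq_conjTranspose_mul_self
  convert posSemidef_conjTranspose_mul_self (B.map (fun x => (x : ℂ))) using 1
  ext i j
  simp [mul_apply]

/-- The determinant is monotone under adding a positive semidefinite matrix. -/
theorem PosDef.det_le_det_add {A B : Matrix n n 𝕜} (hA : A.PosDef) (hB : B.PosSemidef) :
    A.det ≤ (A + B).det := by
  obtain ⟨W, rfl⟩ := hB.exists_eq_conjTranspose_mul_self
  rw [det_add_mul _ _ ((isUnit_iff_isUnit_det A).mp hA.isUnit)]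
  exact le_mul_of_one_le_right hA.det_pos.le
    (hA.inv.posSemidef.mul_mul_conjTranspose_same W).one_le_det_one_add

/-- **Fischer's inequality**. -/
theorem PosSemidef.det_fromBlocks_le {A : Matrix m m 𝕜} {B : Matrix m n 𝕜} {C : Matrix n m 𝕜}
    {D : Matrix n n 𝕜} (h : (fromBlocks A B C D).PosSemidef) :
    (fromBlocks A B C D).det ≤ A.det * D.det := by
  have hA : A.PosSemidef := h.submatrix Sum.inl
  have hD : D.PosSemidef := h.submatrix Sum.inr
  obtain rfl : Bᴴ = C := (isHermitian_fromBlocks_iff.mp h.isHermitian).2.1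
  by_cases h0 : (fromBlocks A B Bᴴ D).det = 0
  · rw [h0]
    exact mul_nonneg hA.det_nonneg hD.det_nonneg
  have hpos := h.posDef_iff_det_ne_zero.mpr h0
  have hA' : A.PosDef := hpos.submatrix Sum.inl_injective
  let := hA'.isUnit.invertible
  rw [det_fromBlocks₁₁, invOf_eq_nonsing_inv] at h0 ⊢
  have hS : (D - Bᴴ * A⁻¹ * B).PosSemidef := (hA'.fromBlocks₁₁ B D).mp h
  have hS' := hS.posDef_iff_det_ne_zero.mpr (right_ne_zero_of_mul h0)
  refine mul_le_mul_of_nonneg_left ?_ hA.det_nonneg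
  simpa using hS'.det_le_det_add (hA.inv.conjTranspose_mul_mul_same B)

theorem normSq_det_fromBlocks_one_I :
    (fromBlocks 1 1 (Complex.I • 1) (-Complex.I • 1) : Matrix (n ⊕ n) (n ⊕ n) ℂ)ᴴ.det *
      (fromBlocks 1 1 (Complex.I • 1) (-Complex.I • 1) : Matrix (n ⊕ n) (n ⊕ n) ℂ).det =
      4 ^ Fintype.card n := by
  rw [det_conjTranspose, det_fromBlocks_one₁₁, Matrix.mul_one, ← sub_smul, det_smul, det_one,
    mul_one, star_pow, ← mul_pow]
  congr 1
  simp
  ring_nf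
  simp

end Matrix

/-- `det A ≤ 4ⁿ (det H)²` for a real symmetric positive semidefinite block
matrix `A = [[P, Q], [Qᵀ, R]]` and the associated Hermitian matrix
`H = (1/4)(P + R + i(Q − Qᵀ))`. -/
theorem det_le_pow_det_hermitian_sq
    (n : ℕ) (hn : 1 ≤ n) (P Q R : Matrix (Fin n) (Fin n) ℝ)
    (hP : P.IsSymm) (hR : R.IsSymm)
    (hA : (Matrix.fromBlocks P Q Qᵀ R).PosSemidef) :
    (((Matrix.fromBlocks P Q Qᵀ R).det : ℝ) : ℂ) ≤ (4 : ℂ) ^ n * (Hmat n P Q R).det ^ 2 := by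
  set A := Matrix.fromBlocks P Q Qᵀ R with hAdef
  set U : Matrix (Fin n ⊕ Fin n) (Fin n ⊕ Fin n) ℂ :=
    fromBlocks 1 1 (Complex.I • 1) (-Complex.I • 1) with hU
  set H := Hmat n P Q R with hH
  have hconj : ∃ X Y, Uᴴ * A.map (fun x => (x : ℂ)) * U =
      fromBlocks ((4 : ℂ) • H) X Y ((4 : ℂ) • Hᵀ) := by
    have h := fromBlocks_toBlocks (Uᴴ * A.map (fun x => (x : ℂ)) * U)
    refine ⟨_, _, h.symm.trans (congrArg₂ (fun S T => fromBlocks S _ _ T) ?_ ?_)⟩ <;>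
    · rw [hU, hAdef, fromBlocks_map, fromBlocks_conjTranspose, fromBlocks_multiply,
        fromBlocks_multiply]
      ext i j
      have hPij := hP.apply i j
      have hRij := hR.apply i j
      simp [hH, Hmat, hPij, hRij]
      ring_nf
      simp
  obtain ⟨X, Y, hXY⟩ := hconj
  have hM := hA.map_ofReal.conjTranspose_mul_mul_same U
  have hdet : (A.map (fun x => (x : ℂ))).det = (A.det : ℂ) :=
    (Complex.ofRealHom.map_det A).symm
  have h1 : (Uᴴ * A.map (fun x => (x : ℂ)) * U).det = 4 ^ n * (A.det : ℂ) := by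
    rw [det_mul, det_mul, mul_right_comm, normSq_det_fromBlocks_one_I, hdet, Fintype.card_fin]
  rw [hXY] at hM h1
  have h2 := hM.det_fromBlocks_le
  rw [h1, det_smul, det_smul, det_transpose, Fintype.card_fin] at h2
  have h4 : (0 : ℂ) < 4 ^ n := by positivity
  refine le_of_mul_le_mul_left (h2.trans_eq ?_) h4
  ring
end
end
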